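/- Let R be a commutative noetherian ring that is n-Gorenstein for some n ≥ 1, i.e. the injective dimension of R as an R-module equals n. Then fdd(R) = 1. In particular, for every m ≥ 1, the polynomial ring R[X_1, …, X_m] and the Laurent polynomial ring R[X_1^{±1}, …, X_m^{±1}] satisfy fdd(R[X_1, …, X_m]) = 1 and fdd(R[X_1^{±1}, …, X_m^{±1}]) = 1. -/

import Mathlib

/-!
Statement 18: If `R` is a commutative noetherian `n`-Gorenstein ring with `n ≥ 1` (i.e.
the injective dimension of `R` as an `R`-module equals `n`), then `fdd(R) = 1`; in
particular `fdd(R[X_1, …, X_m]) = 1` and `fdd(R[X_1^{±1}, …, X_m^{±1}]) = 1` for all `m ≥ 1`.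
-/

universe u

/-- `fddGE R n M` holds iff there is an exact sequence
`0 → M → I^0 → ⋯ → I^(n-1)` of `R`-modules in which every `I^j` is both
flat and injective; i.e. the flat-dominant dimension of `M` is at least `n`. -/
def fddGE (R : Type u) [CommRing R] :
    ℕ → (M : Type u) → [AddCommGroup M] → [Module R M] → Prop
  | 0, _, _, _ => True
  | (n+1), M, iM, mM =>
      letI := iM; letI := mM
      ∃ (I : Type u) (_ : AddCommGroup I) (_ : Module R I),
        Module.Flat R I ∧ Module.Injective R I ∧
        ∃ f : M →ₗ[R] I, Function.Injective f ∧ fddGE R n (I ⧸ LinearMap.range f)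

/-- `injDimLE R n M` holds iff `M` admits an injective resolution
`0 → M → I^0 → ⋯ → I^n → 0`, i.e. the injective dimension of `M` is at most `n`. -/
def injDimLE (R : Type u) [CommRing R] :
    ℕ → (M : Type u) → [AddCommGroup M] → [Module R M] → Prop
  | 0, M, iM, mM =>
      letI := iM; letI := mM
      Module.Injective R M
  | (n+1), M, iM, mM =>
      letI := iM; letI := mM
      ∃ (I : Type u) (_ : AddCommGroup I) (_ : Module R I), Module.Injective R I ∧
        ∃ f : M →ₗ[R] I, Function.Injective f ∧ injDimLE R n (I ⧸ LinearMap.range f)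

open CategoryTheory Abelian

/-- Baer-type criterion for injective dimension. -/
theorem hasInjectiveDimensionLT_of_ext_quotient {R : Type u} [CommRing R] (n : ℕ)
    (X : ModuleCat.{u} R)
    (h : ∀ I : Ideal R, Subsingleton (Ext (ModuleCat.of R (R ⧸ I)) X (n + 1))) :
    HasInjectiveDimensionLT X (n + 1) := by
  induction n generalizing X with
  | zero =>
    have hX : Module.Injective R X := by
      refine Module.Baer.injective fun I g ↦ ?_
      have hS := ModuleCat.shortComplex_shortExact
        (ModuleCat.shortComplexOfCompEqZero I.subtype I.mkQ
          (LinearMap.exact_subtype_mkQ I).linearMap_comp_eq_zero)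
        (LinearMap.exact_subtype_mkQ I) I.injective_subtype (Submodule.mkQ_surjective I)
      obtain ⟨y, hy⟩ := Ext.contravariant_sequence_exact₁ hS X
        (Ext.mk₀ (ModuleCat.ofHom g)) (n₁ := 1) rfl ((h I).elim _ _)
      obtain ⟨f, rfl⟩ := (Ext.mk₀_bijective _ _).2 y
      rw [Ext.mk₀_comp_mk₀] at hy
      have hfg := (Ext.mk₀_bijective _ _).1 hy
      exact ⟨f.hom, fun x hx ↦ congr($(hfg).hom ⟨x, hx⟩)⟩
    have := Module.injective_object_of_injective_module R X
    infer_instance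
  | succ n ih =>
    obtain ⟨I, _, f, _⟩ := EnoughInjectives.presentation X
    have hS : (ShortComplex.mk f (Limits.cokernel.π f) (Limits.cokernel.condition f)).ShortExact :=
      { exact := ShortComplex.exact_cokernel f }
    refine (hS.hasInjectiveDimensionLT_X₃_iff n ‹_›).mp (ih _ fun J ↦ ⟨fun a b ↦ ?_⟩)
    suffices ∀ a : Ext (ModuleCat.of R (R ⧸ J)) (Limits.cokernel f) (n + 1), a = 0 by
      rw [this a, this b]
    intro a
    obtain ⟨c, rfl⟩ := Ext.covariant_sequence_exact₃ _ hS a rfl ((h J).elim _ _)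
    rw [Ext.eq_zero_of_injective c, Ext.zero_comp]

/-- A finite module is trivial if every maximal ideal containing its annihilator has an element
acting surjectively on it. -/
theorem subsingleton_of_forall_isMaximal {R E : Type*} [CommRing R] [AddCommGroup E] [Module R E]
    [Module.Finite R E]
    (h : ∀ m : Ideal R, m.IsMaximal → Module.annihilator R E ≤ m →
      ∃ x ∈ m, Function.Surjective fun e : E ↦ x • e) : Subsingleton E := by
  by_contra hE
  have hne : Module.annihilator R E ≠ ⊤ := by
    rwa [Ne, Module.annihilator_eq_top_iff]
  obtain ⟨m, hm, hle⟩ := Ideal.exists_le_maximal _ hne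
  obtain ⟨x, hx, hsurj⟩ := h m hm hle
  obtain ⟨r, hr, hr0⟩ := Submodule.exists_sub_one_mem_and_smul_eq_zero_of_fg_of_le_smul m
    (⊤ : Submodule R E) Module.Finite.fg_top fun e _ ↦ by
      obtain ⟨e, rfl⟩ := hsurj e
      exact Submodule.smul_mem_smul hx trivial
  have : r ∈ m := hle (Module.mem_annihilator.mpr fun e ↦ hr0 e trivial)
  exact hm.ne_top ((Ideal.eq_top_iff_one m).mpr (by simpa using m.sub_mem this hr))

section
variable {R : Type u} [CommRing R] {n : ℕ} {X : ModuleCat.{u} R}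

theorem ext_precomp_surjective_of_injective [HasInjectiveDimensionLT X (n + 1)]
    {M N : Type u} [AddCommGroup M] [Module R M] [AddCommGroup N] [Module R N]
    (f : M →ₗ[R] N) (hf : Function.Injective f) (a : Ext (ModuleCat.of R M) X n) :
    ∃ b : Ext (ModuleCat.of R N) X n,
      (Ext.mk₀ (ModuleCat.ofHom f)).comp b (zero_add n) = a := by
  have hS := ModuleCat.shortComplex_shortExact
    (ModuleCat.shortComplexOfCompEqZero _ _ f.exact_map_mkQ_range.linearMap_comp_eq_zero)
    f.exact_map_mkQ_range hf (Submodule.mkQ_surjective _)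
  exact Ext.contravariant_sequence_exact₁ hS X a (add_comm 1 n)
    (Ext.eq_zero_of_hasInjectiveDimensionLT _ (n + 1) le_rfl)

theorem ext_quotient_maximal_subsingleton [IsNoetherianRing R] [IsFractionRing R R]
    [HasInjectiveDimensionLT X (n + 2)] (m : Ideal R) [m.IsMaximal] {N : Type u} [AddCommGroup N]
    [Module R N] (e : N ≃ₗ[R] R ⧸ m) :
    Subsingleton (Ext (ModuleCat.of R N) X (n + 1)) := by
  obtain ⟨f, hf⟩ : ∃ f : (R ⧸ m) →ₗ[R] R, Function.Injective f := by
    have h := Ideal.IsMaximal.mem_associatedPrimes_of_isFractionRing (A := R) m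
    rw [AssociatedPrimes.mem_iff, isAssociatedPrime_iff_exists_injective_linearMap] at h
    exact h.2
  refine subsingleton_of_forall_eq 0 fun a ↦ ?_
  obtain ⟨b, rfl⟩ := ext_precomp_surjective_of_injective (f ∘ₗ e.toLinearMap)
    (hf.comp e.injective) a
  rw [Ext.eq_zero_of_projective b, Ext.comp_zero]

theorem ext_quotient_prime_subsingleton [IsNoetherianRing R] [IsFractionRing R R]
    [Module.Finite R X]
    [HasInjectiveDimensionLT X (n + 2)] (p : Ideal R) [p.IsPrime] {N : Type u} [AddCommGroup N]
    [Module R N] (e : N ≃ₗ[R] R ⧸ p) :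
    Subsingleton (Ext (ModuleCat.of R N) X (n + 1)) := by
  by_cases hp : p.IsMaximal
  · exact ext_quotient_maximal_subsingleton p e
  have : Module.Finite R N := Module.Finite.equiv e.symm
  have smul_eq (x : R) (a : Ext (ModuleCat.of R N) X (n + 1)) :
      x • a = (Ext.mk₀ (ModuleCat.ofHom (LinearMap.lsmul R N x))).comp a (zero_add _) := by
    have : ModuleCat.ofHom (LinearMap.lsmul R N x) = x • 𝟙 (ModuleCat.of R N) := by ext; simp
    rw [this, Ext.mk₀_smul, Ext.smul_comp, Ext.mk₀_id_comp]
  refine subsingleton_of_forall_isMaximal (R := R) fun m hm hle ↦ ?_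
  have hpm : p ≤ m := fun x hx ↦ hle <| Module.mem_annihilator.mpr fun a ↦ by
    have : LinearMap.lsmul R N x = 0 := by
      ext y
      apply e.injective
      rw [LinearMap.lsmul_apply, map_smul, Algebra.smul_def, Ideal.Quotient.algebraMap_eq,
        Ideal.Quotient.eq_zero_iff_mem.mpr hx, zero_mul, LinearMap.zero_apply, map_zero]
    rw [smul_eq, this, ModuleCat.ofHom_zero, Ext.mk₀_zero, Ext.zero_comp]
  obtain ⟨x, hxm, hxp⟩ := SetLike.exists_of_lt (lt_of_le_of_ne hpm (by rintro rfl; exact hp hm))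
  refine ⟨x, hxm, fun a ↦ ?_⟩
  have hinj : Function.Injective (LinearMap.lsmul R N x) := fun y z hyz ↦ by
    apply e.injective
    apply mul_left_cancel₀ (mt Ideal.Quotient.eq_zero_iff_mem.mp hxp)
    simpa only [LinearMap.lsmul_apply, map_smul, Algebra.smul_def,
      Ideal.Quotient.algebraMap_eq] using congr(e $hyz)
  obtain ⟨b, hb⟩ := ext_precomp_surjective_of_injective _ hinj a
  exact ⟨b, (smul_eq x b).trans hb⟩

theorem ext_subsingleton_of_finite [IsNoetherianRing R] [IsFractionRing R R]
    [Module.Finite R X]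
    [HasInjectiveDimensionLT X (n + 2)] {M : Type u} [AddCommGroup M]
    [Module R M] (hM : Module.Finite R M) :
    Subsingleton (Ext (ModuleCat.of R M) X (n + 1)) := by
  induction hM using IsNoetherianRing.induction_on_isQuotientEquivQuotientPrime R with
  | subsingleton N =>
    refine subsingleton_of_forall_eq 0 fun a ↦ ?_
    have : Projective (ModuleCat.of R N) :=
      (ModuleCat.isZero_of_subsingleton (ModuleCat.of R N)).projective
    exact Ext.eq_zero_of_projective a
  | quotient N p e => exact ext_quotient_prime_subsingleton p.1 e
  | exact N₁ N₂ N₃ f g hf hg hfg h₁ h₃ =>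
    have hS := ModuleCat.shortComplex_shortExact
      (ModuleCat.shortComplexOfCompEqZero f g hfg.linearMap_comp_eq_zero) hfg hf hg
    refine subsingleton_of_forall_eq 0 fun a ↦ ?_
    obtain ⟨b, rfl⟩ := Ext.contravariant_sequence_exact₂ hS X a (h₁.elim _ _)
    rw [h₃.elim b 0, Ext.comp_zero]

theorem injective_of_hasInjectiveDimensionLE [IsNoetherianRing R] [IsFractionRing R R]
    [Module.Finite R X] [HasInjectiveDimensionLE X n] : Injective X := by
  rw [injective_iff_hasInjectiveDimensionLT_one]
  have h : HasInjectiveDimensionLT X (n + 1) := ‹_›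
  induction n with
  | zero => exact h
  | succ n ih =>
    have := hasInjectiveDimensionLT_of_ext_quotient n X fun I ↦ ext_subsingleton_of_finite
      inferInstance
    exact ih this
end

open scoped Polynomial

/-- Over a noetherian ring, direct sums of copies of an injective module are injective. -/
theorem Module.Injective.finsupp {R : Type u} [CommRing R] [IsNoetherianRing R] {ι : Type}
    (M : Type u) [AddCommGroup M] [Module R M] [Module.Injective R M] :
    Module.Injective R (ι →₀ M) := by
  classical
  refine Module.Baer.injective fun I g ↦ ?_
  obtain ⟨s, hs⟩ : (⊤ : Submodule R I).FG := Module.Finite.fg_top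
  let t : Finset ι := s.biUnion fun x ↦ (g x).support
  have ht (x : I) : g x ∈ Finsupp.supported M R (t : Set ι) := by
    have hx : x ∈ Submodule.span R (s : Set I) := hs ▸ trivial
    have hle : Submodule.span R (s : Set I) ≤ (Finsupp.supported M R (t : Set ι)).comap g :=
      Submodule.span_le.mpr fun y hy ↦ by
        exact Finset.coe_subset.mpr (Finset.subset_biUnion_of_mem (fun x ↦ (g x).support) hy)
    exact hle hx
  choose l hl using fun i : ι ↦ Module.Baer.of_injective ‹Module.Injective R M› I
    ((Finsupp.lapply i).comp g)
  refine ⟨∑ i ∈ t, (Finsupp.lsingle i).comp (l i), fun x hx ↦ ?_⟩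
  ext i
  simp only [LinearMap.sum_apply, LinearMap.comp_apply, Finsupp.finsetSum_apply, hl _ x hx,
    Finsupp.lsingle_apply, Finsupp.lapply_apply, Finsupp.single_apply]
  rw [Finset.sum_ite_eq' t i]
  split_ifs with hi
  · rfl
  · exact (Finsupp.notMem_support_iff.mp fun h ↦ hi (ht ⟨x, hx⟩ h)).symm

/-- An `R`-linear map between `R[X]`-modules commuting with `X` is `R[X]`-linear. -/
def LinearMap.extendScalarsPolynomial {R M N : Type*} [CommRing R] [AddCommGroup M] [Module R M]
    [Module R[X] M] [IsScalarTower R R[X] M] [AddCommGroup N] [Module R N] [Module R[X] N]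
    [IsScalarTower R R[X] N] (f : M →ₗ[R] N)
    (hf : ∀ m, f ((Polynomial.X : R[X]) • m) = (Polynomial.X : R[X]) • f m) : M →ₗ[R[X]] N where
  __ := f
  map_smul' p m := by
    induction p using Polynomial.induction_on generalizing m with
    | C a => simp [Polynomial.C_eq_algebraMap]
    | add p q hp hq => simp_all [add_smul]
    | monomial n a h =>
      simp only [pow_succ, ← mul_assoc, mul_smul _ Polynomial.X, AddHom.toFun_eq_coe,
        LinearMap.coe_toAddHom, RingHom.id_apply] at h ⊢
      rw [h, hf]

section
variable {R : Type u} [CommRing R] {N : Type u} [AddCommGroup N] [Module R N]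

/-- The left shift on sequences. -/
def seqShift (R : Type u) [CommRing R] (N : Type u) [AddCommGroup N] [Module R N] :
    Module.End R (ℕ → N) :=
  LinearMap.funLeft R N Nat.succ

/-- The `R[X]`-module of sequences in `N`, on which `X` acts as the left shift; this is the
module coinduced from the `R`-module `N`. -/
abbrev SeqModule (R : Type u) [CommRing R] (N : Type u) [AddCommGroup N] [Module R N] : Type u :=
  Module.AEval' (seqShift R N)

/-- The terms of an element of `SeqModule R N`. -/
def SeqModule.term (φ : SeqModule R N) (k : ℕ) : N :=
  (Module.AEval'.of (seqShift R N)).symm φ k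

theorem SeqModule.term_X_smul (φ : SeqModule R N) (k : ℕ) :
    ((Polynomial.X : R[X]) • φ).term k = φ.term (k + 1) := by
  rw [SeqModule.term, Module.AEval'.of_symm_X_smul]
  rfl

theorem SeqModule.ext {φ ψ : SeqModule R N} (h : ∀ k, φ.term k = ψ.term k) : φ = ψ :=
  (Module.AEval'.of (seqShift R N)).symm.injective (funext h)

/-- The `R[X]`-linear map into `SeqModule R N` with prescribed terms. -/
noncomputable def SeqModule.lift {Y : Type u} [AddCommGroup Y] [Module R Y] [Module R[X] Y]
    [IsScalarTower R R[X] Y] (h : ℕ → Y →ₗ[R] N)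
    (hX : ∀ k y, h k ((Polynomial.X : R[X]) • y) = h (k + 1) y) :
    Y →ₗ[R[X]] SeqModule R N :=
  LinearMap.extendScalarsPolynomial
    ((Module.AEval'.of (seqShift R N)).toLinearMap ∘ₗ LinearMap.pi h)
    fun y ↦ SeqModule.ext fun k ↦ by rw [SeqModule.term_X_smul]; exact hX k y

theorem SeqModule.term_lift {Y : Type u} [AddCommGroup Y] [Module R Y] [Module R[X] Y]
    [IsScalarTower R R[X] Y] (h : ℕ → Y →ₗ[R] N)
    (hX : ∀ k y, h k ((Polynomial.X : R[X]) • y) = h (k + 1) y) (y : Y) (k : ℕ) :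
    (SeqModule.lift h hX y).term k = h k y := rfl

/-- `SeqModule.term` as a linear map. -/
noncomputable def SeqModule.termₗ (k : ℕ) : SeqModule R N →ₗ[R] N :=
  (LinearMap.proj k).comp (Module.AEval'.of (seqShift R N)).symm.toLinearMap

theorem SeqModule.term_X_pow_smul (φ : SeqModule R N) (j k : ℕ) :
    ((Polynomial.X : R[X]) ^ j • φ).term k = φ.term (k + j) := by
  induction j generalizing φ with
  | zero => simp
  | succ j ih => rw [pow_succ, mul_smul, ih, SeqModule.term_X_smul]; rfl

instance SeqModule.injective [Module.Injective R N] :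
    Module.Injective R[X] (SeqModule R N) where
  out Y Z _ _ _ _ f hf g := by
    let _ : Module R Y := Module.compHom Y (algebraMap R R[X])
    let _ : Module R Z := Module.compHom Z (algebraMap R R[X])
    have : IsScalarTower R R[X] Y := IsScalarTower.of_algebraMap_smul fun _ _ ↦ rfl
    have : IsScalarTower R R[X] Z := IsScalarTower.of_algebraMap_smul fun _ _ ↦ rfl
    obtain ⟨h, hh⟩ := Module.Injective.extension_property R N Y Z (f.restrictScalars R) hf
      ((SeqModule.termₗ 0).comp (g.restrictScalars R))
    refine ⟨SeqModule.lift
      (fun k ↦ h.comp ((LinearMap.lsmul R[X] Z (Polynomial.X ^ k)).restrictScalars R))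
      fun k z ↦ ?_, fun y ↦ SeqModule.ext fun k ↦ ?_⟩
    · simp [pow_succ, mul_smul, smul_comm ((Polynomial.X : R[X]) ^ k)]
    · rw [SeqModule.term_lift]
      simp only [LinearMap.comp_apply, LinearMap.restrictScalars_apply, LinearMap.lsmul_apply,
        ← map_smul]
      refine (LinearMap.congr_fun hh ((Polynomial.X : R[X]) ^ k • y)).trans ?_
      simp only [LinearMap.comp_apply, LinearMap.restrictScalars_apply, map_smul]
      refine (SeqModule.term_X_pow_smul _ k 0).trans (by rw [zero_add])

theorem hasInjectiveDimensionLE_one_of_injective_restrictScalars [Module R[X] N]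
    [IsScalarTower R R[X] N] [Module.Injective R N] :
    HasInjectiveDimensionLE (ModuleCat.of R[X] N) 1 := by
  let i : N →ₗ[R[X]] SeqModule R N :=
    SeqModule.lift (fun k ↦ (LinearMap.lsmul R[X] N (Polynomial.X ^ k)).restrictScalars R)
      fun k y ↦ by simp [pow_succ, mul_smul, smul_comm ((Polynomial.X : R[X]) ^ k)]
  let d : SeqModule R N →ₗ[R[X]] SeqModule R N :=
    SeqModule.lift (fun k ↦ SeqModule.termₗ (k + 1) -
      ((LinearMap.lsmul R[X] N Polynomial.X).restrictScalars R).comp (SeqModule.termₗ k))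
      fun k φ ↦ congr_arg₂ (· - (Polynomial.X : R[X]) • ·) (SeqModule.term_X_smul φ (k + 1))
        (SeqModule.term_X_smul φ k)
  have hi (n : N) (k : ℕ) : (i n).term k = (Polynomial.X : R[X]) ^ k • n := rfl
  have hd (φ : SeqModule R N) (k : ℕ) :
      (d φ).term k = φ.term (k + 1) - (Polynomial.X : R[X]) • φ.term k := rfl
  have hi_inj : Function.Injective i := fun a b hab ↦ by
    simpa [hi] using congr(SeqModule.term $hab 0)
  have hd_surj : Function.Surjective d := fun ψ ↦ by
    let φ : ℕ → N := fun k ↦ k.rec 0 fun k x ↦ ψ.term k + (Polynomial.X : R[X]) • x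
    refine ⟨Module.AEval'.of (seqShift R N) φ, SeqModule.ext fun k ↦ ?_⟩
    rw [hd]
    exact add_sub_cancel_right _ _
  have hex : Function.Exact i d := fun φ ↦ by
    constructor
    · intro h
      have h' (k : ℕ) : φ.term (k + 1) = (Polynomial.X : R[X]) • φ.term k :=
        sub_eq_zero.mp ((hd φ k).symm.trans congr(SeqModule.term $h k))
      refine ⟨φ.term 0, SeqModule.ext fun k ↦ ?_⟩
      rw [hi]
      induction k with
      | zero => simp
      | succ k ih => rw [h', ← ih, pow_succ', mul_smul]
    · rintro ⟨n, rfl⟩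
      refine SeqModule.ext fun k ↦ ?_
      rw [hd, hi, hi, pow_succ', mul_smul, sub_self]
      rfl
  have hS := ModuleCat.shortComplex_shortExact
    (ModuleCat.shortComplexOfCompEqZero i d hex.linearMap_comp_eq_zero) hex hi_inj hd_surj
  have := Module.injective_object_of_injective_module R[X] (SeqModule R N)
  exact hS.hasInjectiveDimensionLT_X₁ 1 inferInstance inferInstance

/-- The `R[X]`-linear map `M[X] → N[X]` induced by an `R`-linear map `M → N`. -/
noncomputable def PolynomialModule.mapPolynomial {M : Type u} [AddCommGroup M] [Module R M]
    (f : M →ₗ[R] N) :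
    PolynomialModule R M →ₗ[R[X]] PolynomialModule R N where
  __ := PolynomialModule.map R f
  map_smul' p q := by
    simpa using PolynomialModule.map_smul (R' := R) f p q

theorem PolynomialModule.hasInjectiveDimensionLE [IsNoetherianRing R] (n : ℕ) (M : ModuleCat.{u} R)
    [HasInjectiveDimensionLE M n] :
    HasInjectiveDimensionLE (ModuleCat.of R[X] (PolynomialModule R M)) (n + 1) := by
  have hinj (I : ModuleCat.{u} R) [Injective I] :
      HasInjectiveDimensionLE (ModuleCat.of R[X] (PolynomialModule R I)) 1 := by
    have := Module.injective_module_of_injective_object R I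
    have := Module.Injective.finsupp (ι := ℕ) (R := R) I
    have : Module.Injective R (PolynomialModule R I) :=
      Module.Baer.injective (Module.Baer.of_equiv (PolynomialModule.coeffLinearEquiv R R).symm
        (Module.Baer.of_injective this))
    exact hasInjectiveDimensionLE_one_of_injective_restrictScalars
  have h : HasInjectiveDimensionLT M (n + 1) := ‹_›
  induction n generalizing M with
  | zero =>
    have := injective_iff_hasInjectiveDimensionLT_one.mpr h
    exact hinj M
  | succ n ih =>
    obtain ⟨I, _, f, _⟩ := EnoughInjectives.presentation M
    have hf : Function.Injective f.hom := (ModuleCat.mono_iff_injective f).mp ‹_›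
    have hex := f.hom.exact_map_mkQ_range
    have hS := ModuleCat.shortComplex_shortExact
      (ModuleCat.shortComplexOfCompEqZero _ _ hex.linearMap_comp_eq_zero)
      hex hf (Submodule.mkQ_surjective _)
    have h₃ : HasInjectiveDimensionLT (ModuleCat.of R (I ⧸ LinearMap.range f.hom)) (n + 1) :=
      (hS.hasInjectiveDimensionLT_X₃_iff n ‹_›).mpr h
    have hfP : Function.Injective (mapPolynomial f.hom) := fun a b hab ↦
      PolynomialModule.coeff_injective
        (Finsupp.mapRange_injective _ (map_zero _) hf congr(($hab).coeff))
    have hgP : Function.Surjective (mapPolynomial (LinearMap.range f.hom).mkQ) := fun b ↦ by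
      obtain ⟨a, ha⟩ := Finsupp.mapRange_surjective _ (map_zero _)
        (Submodule.mkQ_surjective (LinearMap.range f.hom)) b.coeff
      exact ⟨.ofCoeff R a, PolynomialModule.coeff_injective ha⟩
    have hexP : Function.Exact (mapPolynomial f.hom) (mapPolynomial (LinearMap.range f.hom).mkQ) :=
      fun b ↦ by
        constructor
        · intro hb
          have hb' (k : ℕ) : b.coeff k ∈ Set.range f.hom :=
            (hex _).mp congr(($hb).coeff k)
          choose a ha using hb'
          have ha0 (k : ℕ) (hk : k ∉ b.coeff.support) : a k = 0 :=
            hf (by rw [ha, Finsupp.notMem_support_iff.mp hk, map_zero])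
          refine ⟨.ofCoeff R (Finsupp.onFinset b.coeff.support a fun k hk ↦ by
            by_contra h; exact hk (ha0 k h)), PolynomialModule.coeff_injective ?_⟩
          ext k
          exact ha k
        · rintro ⟨a, rfl⟩
          apply PolynomialModule.coeff_injective
          ext k
          exact hex.apply_apply_eq_zero (a.coeff k)
    have hSP := ModuleCat.shortComplex_shortExact
      (ModuleCat.shortComplexOfCompEqZero _ _ hexP.linearMap_comp_eq_zero) hexP hfP hgP
    have h₂ := hinj I
    exact hSP.hasInjectiveDimensionLT_X₁ _ (ih _ h₃) (hasInjectiveDimensionLT_of_ge _ 2 _ (by lia))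

end

/-- A noetherian ring of finite self-injective dimension. -/
def IsGorensteinRing (R : Type u) [CommRing R] : Prop :=
  IsNoetherianRing R ∧ ∃ n, HasInjectiveDimensionLE (ModuleCat.of R R) n

theorem IsGorensteinRing.polynomial {R : Type u} [CommRing R] (h : IsGorensteinRing R) :
    IsGorensteinRing R[X] := by
  obtain ⟨_, n, _⟩ := h
  refine ⟨inferInstance, n + 1, ?_⟩
  have := PolynomialModule.hasInjectiveDimensionLE n (ModuleCat.of R R)
  exact hasInjectiveDimensionLT_of_iso
    (PolynomialModule.equivPolynomialSelf (R := R)).toModuleIso (n + 2)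

theorem IsGorensteinRing.of_ringEquiv {R S : Type u} [CommRing R] [CommRing S] (e : R ≃+* S)
    (h : IsGorensteinRing R) : IsGorensteinRing S := by
  obtain ⟨_, n, hn⟩ := h
  have := RingHomInvPair.of_ringEquiv e
  have := RingHomInvPair.symm (RingHomClass.toRingHom e) (RingHomClass.toRingHom e.symm)
  refine ⟨isNoetherianRing_of_ringEquiv R e, n, ?_⟩
  exact (ModuleCat.hasInjectiveDimensionLE_iff_of_semiLinearEquiv (M := ModuleCat.of R R)
    (N := ModuleCat.of S S) (eR := e) e.toSemilinearEquiv n).mp hn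

theorem ModuleCat.hasInjectiveDimensionLE_of_isLocalizedModule {R : Type u} [CommRing R]
    [IsNoetherianRing R] (S : Submonoid R) (M : ModuleCat.{u} R) (n : ℕ)
    [HasInjectiveDimensionLE M n] {N : Type u} [AddCommGroup N] [Module R N]
    [Module (Localization S) N] [IsScalarTower R (Localization S) N] (f : M →ₗ[R] N)
    [IsLocalizedModule S f] : HasInjectiveDimensionLE (ModuleCat.of (Localization S) N) n := by
  have := ModuleCat.localizedModule_hasInjectiveDimensionLE n S M
  let e := (IsLocalizedModule.linearEquiv S (M.localizedModuleMkLinearMap S)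
    f).extendScalarsOfIsLocalization S (Localization S)
  exact hasInjectiveDimensionLT_of_iso (X' := ModuleCat.of _ N) e.toModuleIso (n + 1)

theorem IsGorensteinRing.localization {R : Type u} [CommRing R] (S : Submonoid R)
    (h : IsGorensteinRing R) : IsGorensteinRing (Localization S) := by
  obtain ⟨_, n, hn⟩ := h
  exact ⟨IsLocalization.isNoetherianRing S _ ‹_›, n,
    ModuleCat.hasInjectiveDimensionLE_of_isLocalizedModule S (ModuleCat.of R R) n
      (Algebra.linearMap R (Localization S))⟩

theorem IsGorensteinRing.injective {R : Type u} [CommRing R] [IsFractionRing R R]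
    (h : IsGorensteinRing R) : Module.Injective R R := by
  obtain ⟨_, n, hn⟩ := h
  have : Module.Finite R (ModuleCat.of R R) := inferInstanceAs (Module.Finite R R)
  have := injective_of_hasInjectiveDimensionLE (X := ModuleCat.of R R) (n := n)
  exact Module.injective_module_of_injective_object R R

/-- Injective modules over a flat algebra are injective over the base. -/
theorem Module.Injective.restrictScalars_of_flat (A T N : Type u) [CommRing A] [CommRing T]
    [Algebra A T] [Module.Flat A T] [AddCommGroup N] [Module A N] [Module T N]
    [IsScalarTower A T N] [Module.Injective T N] : Module.Injective A N where
  out X Y _ _ _ _ f hf g := by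
    obtain ⟨h, hh⟩ := Module.Injective.extension_property T N _ _ (f.baseChange T)
      (Module.Flat.lTensor_preserves_injective_linearMap f hf) (g.liftBaseChange T)
    refine ⟨(h.restrictScalars A).comp (TensorProduct.mk A T Y 1), fun x ↦ ?_⟩
    simpa using LinearMap.congr_fun hh (1 ⊗ₜ x)

theorem IsGorensteinRing.fddGE_one {A : Type u} [CommRing A] (h : IsGorensteinRing A) :
    fddGE A 1 A := by
  have := (h.localization (nonZeroDivisors A)).injective
  exact ⟨FractionRing A, inferInstance, inferInstance, IsLocalization.flat _ (nonZeroDivisors A),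
    Module.Injective.restrictScalars_of_flat A (FractionRing A) (FractionRing A),
    Algebra.linearMap A (FractionRing A), IsFractionRing.injective A (FractionRing A), trivial⟩

theorem not_fddGE_two {A : Type u} [CommRing A] {s : A} (hs : s ∈ nonZeroDivisors A)
    (hu : ¬ IsUnit s) : ¬ fddGE A 2 A := by
  rintro ⟨I, _, _, -, hI, f, hf, J, _, _, hJ, -, g, hg, -⟩
  obtain ⟨h, hh⟩ := Module.Injective.extension_property A I A A (LinearMap.lsmul A A s)
    (fun a b hab ↦ (mul_cancel_left_mem_nonZeroDivisors hs).mp hab) f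
  have hy : s • h 1 = f 1 := by
    rw [← map_smul]
    exact LinearMap.congr_fun hh 1
  have hz : g (Submodule.Quotient.mk (h 1)) = 0 := by
    refine (Module.Flat.isSMulRegular_of_nonZeroDivisors (M := J) hs) ?_
    dsimp only
    rw [← map_smul, ← Submodule.Quotient.mk_smul, hy,
      (Submodule.Quotient.mk_eq_zero _).mpr (LinearMap.mem_range_self f 1), smul_zero, map_zero]
  obtain ⟨a, ha⟩ := (Submodule.Quotient.mk_eq_zero _).mp (hg (hz.trans (map_zero g).symm))
  refine hu (IsUnit.of_mul_eq_one a (hf ?_))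
  rw [← hy, ← ha, ← map_smul, smul_eq_mul]

theorem injDimLE_of_injective {R : Type u} [CommRing R] (n : ℕ) (M : Type u) [AddCommGroup M]
    [Module R M] [hM : Module.Injective R M] : injDimLE R n M := by
  induction n generalizing M with
  | zero => exact hM
  | succ n ih =>
    refine ⟨M, inferInstance, inferInstance, hM, LinearMap.id, Function.injective_id, ?_⟩
    have : Subsingleton (M ⧸ LinearMap.range (LinearMap.id : M →ₗ[R] M)) := by
      rw [LinearMap.range_id]; infer_instance
    have : Module.Injective R (M ⧸ LinearMap.range (LinearMap.id : M →ₗ[R] M)) :=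
      ⟨fun _ _ _ _ _ _ _ _ _ ↦ ⟨0, fun _ ↦ Subsingleton.elim _ _⟩⟩
    exact ih _

theorem hasInjectiveDimensionLE_of_injDimLE {R : Type u} [CommRing R] {n : ℕ} {M : Type u}
    [AddCommGroup M] [Module R M] (h : injDimLE R n M) :
    HasInjectiveDimensionLE (ModuleCat.of R M) n := by
  induction n generalizing M with
  | zero =>
    have : Module.Injective R M := h
    have := Module.injective_object_of_injective_module R M
    exact (injective_iff_hasInjectiveDimensionLT_one (X := ModuleCat.of R M)).mp this
  | succ n ih =>
    obtain ⟨I, _, _, hI, f, hf, h⟩ := h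
    have hS := ModuleCat.shortComplex_shortExact
      (ModuleCat.shortComplexOfCompEqZero _ _ f.exact_map_mkQ_range.linearMap_comp_eq_zero)
      f.exact_map_mkQ_range hf (Submodule.mkQ_surjective _)
    exact (hS.hasInjectiveDimensionLT_X₃_iff n
      (Module.injective_object_of_injective_module R I)).mp (ih h)

theorem IsGorensteinRing.mvPolynomial {R : Type u} [CommRing R] (h : IsGorensteinRing R) (m : ℕ) :
    IsGorensteinRing (MvPolynomial (Fin m) R) := by
  induction m with
  | zero => exact h.of_ringEquiv (MvPolynomial.isEmptyRingEquiv R (Fin 0)).symm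
  | succ m ih => exact ih.polynomial.of_ringEquiv (MvPolynomial.finSuccEquiv R m).symm.toRingEquiv

theorem IsGorensteinRing.laurentPolynomial {R : Type u} [CommRing R] (h : IsGorensteinRing R) :
    IsGorensteinRing (LaurentPolynomial R) :=
  (h.polynomial.localization (Submonoid.powers Polynomial.X)).of_ringEquiv
    (IsLocalization.algEquiv (Submonoid.powers (Polynomial.X : R[X])) _
      (LaurentPolynomial R)).toRingEquiv

/-- Split off the first coordinate of a finitely supported function on `Fin (m + 1)`. -/
noncomputable def Finsupp.consAddEquiv (m : ℕ) : (Fin (m + 1) →₀ ℤ) ≃+ (Fin m →₀ ℤ) × ℤ where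
  toFun f := (f.tail, f 0)
  invFun p := Finsupp.cons p.2 p.1
  left_inv f := Finsupp.cons_tail f
  right_inv p := by simp
  map_add' f g := Prod.ext (by ext; simp [Finsupp.tail_apply]) rfl

/-- Laurent polynomials in `m + 1` variables are Laurent polynomials in one variable over Laurent
polynomials in `m` variables. -/
noncomputable def LaurentPolynomial.finSuccRingEquiv (R : Type u) [CommRing R] (m : ℕ) :
    AddMonoidAlgebra R (Fin (m + 1) →₀ ℤ) ≃+*
      LaurentPolynomial (AddMonoidAlgebra R (Fin m →₀ ℤ)) :=
  (AddMonoidAlgebra.mapDomainRingEquiv R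
    ((Finsupp.consAddEquiv m).trans AddEquiv.prodComm)).trans AddMonoidAlgebra.curryRingEquiv

theorem IsGorensteinRing.mvLaurentPolynomial {R : Type u} [CommRing R] (h : IsGorensteinRing R)
    (m : ℕ) : IsGorensteinRing (AddMonoidAlgebra R (Fin m →₀ ℤ)) := by
  induction m with
  | zero => exact h.of_ringEquiv (AddMonoidAlgebra.uniqueRingEquiv (R := R) (Fin 0 →₀ ℤ)).symm
  | succ m ih =>
    exact ih.laurentPolynomial.of_ringEquiv (LaurentPolynomial.finSuccRingEquiv R m).symm

theorem mem_nonZeroDivisors_of_ringEquiv {A B : Type*} [CommRing A] [CommRing B] (e : A ≃+* B)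
    {s : A} (hs : s ∈ nonZeroDivisors A) : e s ∈ nonZeroDivisors B := by
  rw [← MulEquivClass.map_nonZeroDivisors e]
  exact Submonoid.mem_map_of_mem e hs

theorem LaurentPolynomial.T_sub_one_mem_nonZeroDivisors (R : Type*) [CommRing R] :
    (LaurentPolynomial.T 1 - 1 : LaurentPolynomial R) ∈ nonZeroDivisors (LaurentPolynomial R) := by
  have h : (Polynomial.X - Polynomial.C 1 : R[X]) ∈ nonZeroDivisors R[X] :=
    (Polynomial.monic_X_sub_C 1).mem_nonZeroDivisors
  have := IsLocalization.map_nonZeroDivisors_le (Submonoid.powers (Polynomial.X : R[X]))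
    (LaurentPolynomial R) (Submonoid.mem_map_of_mem _ h)
  simpa using this

theorem LaurentPolynomial.not_isUnit_T_sub_one (R : Type*) [CommRing R] [Nontrivial R] :
    ¬ IsUnit (LaurentPolynomial.T 1 - 1 : LaurentPolynomial R) := fun h ↦ by
  have := h.map (AddMonoidAlgebra.lift R R ℤ (1 : Multiplicative ℤ →* R))
  simp [LaurentPolynomial.T, -LaurentPolynomial.single_eq_C_mul_T] at this

theorem stmt18 (R : Type u) [CommRing R] [IsNoetherianRing R]
    (n : ℕ) (hn : 1 ≤ n) (hGor₁ : injDimLE R n R) (hGor₂ : ¬ injDimLE R (n - 1) R) :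
    (fddGE R 1 R ∧ ¬ fddGE R 2 R) ∧
    (∀ m : ℕ, 1 ≤ m →
      fddGE (MvPolynomial (Fin m) R) 1 (MvPolynomial (Fin m) R) ∧
      ¬ fddGE (MvPolynomial (Fin m) R) 2 (MvPolynomial (Fin m) R)) ∧
    (∀ m : ℕ, 1 ≤ m →
      fddGE (AddMonoidAlgebra R (Fin m →₀ ℤ)) 1 (AddMonoidAlgebra R (Fin m →₀ ℤ)) ∧
      ¬ fddGE (AddMonoidAlgebra R (Fin m →₀ ℤ)) 2 (AddMonoidAlgebra R (Fin m →₀ ℤ))) := by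
  have hR : IsGorensteinRing R := ⟨‹_›, n, hasInjectiveDimensionLE_of_injDimLE hGor₁⟩
  have hfrac : ¬ IsFractionRing R R := fun _ ↦
    hGor₂ (injDimLE_of_injective (n - 1) R (hM := hR.injective))
  rw [IsFractionRing.self_iff_nonZeroDivisors_le_isUnit, SetLike.not_le_iff_exists] at hfrac
  obtain ⟨s, hs, hu⟩ := hfrac
  have : Nontrivial R := not_subsingleton_iff_nontrivial.mp fun _ ↦ hu (isUnit_of_subsingleton s)
  refine ⟨⟨hR.fddGE_one, not_fddGE_two hs hu⟩, fun m hm ↦ ⟨(hR.mvPolynomial m).fddGE_one, ?_⟩,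
    fun m hm ↦ ⟨(hR.mvLaurentPolynomial m).fddGE_one, ?_⟩⟩
  · obtain ⟨m, rfl⟩ := Nat.exists_eq_succ_of_ne_zero (Nat.one_le_iff_ne_zero.mp hm)
    let e := (MvPolynomial.finSuccEquiv R m).symm.toRingEquiv
    exact not_fddGE_two (mem_nonZeroDivisors_of_ringEquiv e Polynomial.monic_X.mem_nonZeroDivisors)
      fun h ↦ Polynomial.not_isUnit_X ((MulEquiv.isUnit_map e).mp h)
  · obtain ⟨m, rfl⟩ := Nat.exists_eq_succ_of_ne_zero (Nat.one_le_iff_ne_zero.mp hm)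
    let e := (LaurentPolynomial.finSuccRingEquiv R m).symm
    exact not_fddGE_two (mem_nonZeroDivisors_of_ringEquiv e
      (LaurentPolynomial.T_sub_one_mem_nonZeroDivisors _))
      fun h ↦ LaurentPolynomial.not_isUnit_T_sub_one _ ((MulEquiv.isUnit_map e).mp h)
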